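/- arXiv:2504.08079 — 3 statements merged into one kernel-verified Lean document; each statement's English description precedes it below -/
import Mathlib

section
/- Under the diminishing regularization choice (μ_f < 2L_f, γ ≤ 1/(2L_h), η_{0,u} := 1/(γμ_f), η_{0,l} := 2L_f/μ_f, η_k := η_{0,u}/(η_{0,l}+k)), if X*_h̄ is an α-weak sharp minima of order m ≥ 1, then the IR-ISTA averaged iterates satisfy, for every K ≥ 1: ‖x̄_K − x*‖² ≤ 2u_1/(μ_f K) + (2‖∇̃f̄(x*)‖/μ_f)·(u_{2,K}/(αK))^{1/m}, where u_1 := ((2L_f − μ_f)/2)‖x_0 − x*‖² and u_{2,K} := γ(2L_f − μ_f)·( η_0‖x_0 − x*‖²/(2γ) + (f̄* − Ĉ_f̄)·(η_{0,u}²/(η_{0,l}−1))·(η_{0,l} + ln((K + η_{0,l} − 1)/η_{0,l})) ). -/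
open scoped RealInnerProductSpace
open Metric Filter

noncomputable section

section FirstOrder

variable {E : Type*} [NormedAddCommGroup E] [InnerProductSpace ℝ E]

theorem StrongConvexOn.add_convexOn {s : Set E} {c : ℝ} {φ ψ : E → ℝ}
    (hφ : StrongConvexOn s c φ) (hψ : ConvexOn ℝ s ψ) : StrongConvexOn s c (φ + ψ) := by
  have h := UniformConvexOn.add hφ hψ.uniformConvexOn_zero
  rwa [add_zero] at h

theorem strongConvexOn_const_mul_norm_sub_sq (c : ℝ) (v : E) :
    StrongConvexOn Set.univ (2 * c) (fun x ↦ c * ‖x - v‖ ^ 2) := by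
  refine ⟨convex_univ, fun x _ y _ a b _ _ hab ↦ le_of_eq ?_⟩
  obtain rfl : b = 1 - a := by linarith
  have h₁ : a • x + (1 - a) • y - v = (y - v) + a • (x - y) := by module
  have h₂ : x - v = (y - v) + (x - y) := by abel
  simp only [smul_eq_mul]
  rw [h₁, h₂, norm_add_sq_real, norm_add_sq_real, inner_smul_right, norm_smul, mul_pow,
    Real.norm_eq_abs, sq_abs]
  ring

/-- A subgradient of a strongly convex function gives a quadratic lower bound. -/
theorem StrongConvexOn.quadratic_lower_bound {c : ℝ} {φ : E → ℝ} {x g : E}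
    (hφ : StrongConvexOn Set.univ c φ) (hg : ∀ y, φ x + ⟪g, y - x⟫ ≤ φ y) (y : E) :
    φ x + ⟪g, y - x⟫ + c / 2 * ‖y - x‖ ^ 2 ≤ φ y := by
  have key : ∀ t : ℝ, t ∈ Set.Ioo (0 : ℝ) 1 →
      φ x + ⟪g, y - x⟫ + (1 - t) * (c / 2 * ‖y - x‖ ^ 2) ≤ φ y := by
    rintro t ⟨ht₀, ht₁⟩
    have h₁ := hφ.2 (Set.mem_univ y) (Set.mem_univ x) ht₀.le (sub_nonneg.2 ht₁.le)
      (add_sub_cancel t 1)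
    have h₂ := hg (t • y + (1 - t) • x)
    rw [show t • y + (1 - t) • x - x = t • (y - x) by module, inner_smul_right] at h₂
    simp only [smul_eq_mul] at h₁
    refine le_of_mul_le_mul_left ?_ ht₀
    linarith
  have hlim : Tendsto (fun t : ℝ ↦ φ x + ⟪g, y - x⟫ + (1 - t) * (c / 2 * ‖y - x‖ ^ 2))
      (nhdsWithin 0 (Set.Ioi 0)) (nhds (φ x + ⟪g, y - x⟫ + (1 - 0) * (c / 2 * ‖y - x‖ ^ 2))) :=
    (Continuous.tendsto (by fun_prop) 0).mono_left nhdsWithin_le_nhds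
  rw [sub_zero, one_mul] at hlim
  exact le_of_tendsto hlim (eventually_of_mem (Ioo_mem_nhdsGT one_pos) key)

theorem StrongConvexOn.quadratic_growth {c : ℝ} {φ : E → ℝ} {x : E}
    (hφ : StrongConvexOn Set.univ c φ) (hx : ∀ y, φ x ≤ φ y) (y : E) :
    φ x + c / 2 * ‖y - x‖ ^ 2 ≤ φ y := by
  simpa using hφ.quadratic_lower_bound (g := 0) (by simpa using hx) y

variable [CompleteSpace E]

theorem HasGradientAt.hasDerivAt_comp_line {φ : E → ℝ} {g x d : E} {t : ℝ}
    (h : HasGradientAt φ g (x + t • d)) :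
    HasDerivAt (fun s : ℝ ↦ φ (x + s • d)) ⟪g, d⟫ t := by
  have hline : HasDerivAt (fun s : ℝ ↦ x + s • d) d t := by
    simpa using ((hasDerivAt_id t).smul_const d).const_add x
  simpa [Function.comp_def] using! h.hasFDerivAt.comp_hasDerivAt t hline

theorem ConvexOn.add_inner_gradient_le {φ : E → ℝ} {g x : E} (hφ : ConvexOn ℝ Set.univ φ)
    (h : HasGradientAt φ g x) (y : E) : φ x + ⟪g, y - x⟫ ≤ φ y := by
  have hc : ConvexOn ℝ Set.univ (fun s : ℝ ↦ φ (x + s • (y - x))) := by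
    refine ⟨convex_univ, fun s _ t _ a b ha hb hab ↦ ?_⟩
    have := hφ.2 (Set.mem_univ (x + s • (y - x))) (Set.mem_univ (x + t • (y - x))) ha hb hab
    convert this using 2
    obtain rfl : b = 1 - a := by linarith
    simp only [smul_eq_mul]
    module
  have hd : HasDerivAt (fun s : ℝ ↦ φ (x + s • (y - x))) ⟪g, y - x⟫ 0 :=
    HasGradientAt.hasDerivAt_comp_line (by simpa using h)
  have := hc.le_slope_of_hasDerivAt (Set.mem_univ 0) (Set.mem_univ 1) one_pos hd
  simp [slope_def_field] at this
  linarith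

/-- The descent lemma for functions with Lipschitz gradient. -/
theorem le_add_inner_gradient_add_sq {φ : E → ℝ} {φ' : E → E} {L : ℝ}
    (h : ∀ x, HasGradientAt φ (φ' x) x) (hL : ∀ x y, ‖φ' x - φ' y‖ ≤ L * ‖x - y‖) (x y : E) :
    φ y ≤ φ x + ⟪φ' x, y - x⟫ + L / 2 * ‖y - x‖ ^ 2 := by
  set d := y - x with hd
  have hderiv : ∀ t : ℝ, HasDerivAt (fun s : ℝ ↦ φ (x + s • d)) ⟪φ' (x + t • d), d⟫ t :=
    fun t ↦ (h _).hasDerivAt_comp_line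
  have hbound : ∀ t : ℝ, HasDerivAt
      (fun s : ℝ ↦ φ x + s * ⟪φ' x, d⟫ + L / 2 * ‖d‖ ^ 2 * s ^ 2)
      (⟪φ' x, d⟫ + L * ‖d‖ ^ 2 * t) t := by
    intro t
    have := (((hasDerivAt_id t).mul_const ⟪φ' x, d⟫).const_add (φ x)).add
      ((hasDerivAt_pow 2 t).const_mul (L / 2 * ‖d‖ ^ 2))
    exact this.congr_deriv (by norm_num; ring)
  have := image_le_of_deriv_right_le_deriv_boundary (a := 0) (b := 1)
    (fun t _ ↦ (hderiv t).continuousAt.continuousWithinAt)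
    (fun t _ ↦ (hderiv t).hasDerivWithinAt) (by simp)
    (fun t _ ↦ (hbound t).continuousAt.continuousWithinAt)
    (fun t _ ↦ (hbound t).hasDerivWithinAt) ?_ (Set.right_mem_Icc.2 zero_le_one)
  · simpa [hd] using this
  · rintro t ⟨ht, -⟩
    have h₁ : ⟪φ' (x + t • d) - φ' x, d⟫ ≤ L * ‖d‖ ^ 2 * t := by
      refine (real_inner_le_norm _ _).trans ?_
      have h₂ := hL (x + t • d) x
      rw [add_sub_cancel_left, norm_smul, Real.norm_eq_abs, abs_of_nonneg ht] at h₂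
      nlinarith [mul_le_mul_of_nonneg_right h₂ (norm_nonneg d)]
    rw [inner_sub_left] at h₁
    linarith

/-- The fundamental inequality for one regularized proximal gradient step. -/
theorem proximal_gradient_step {f h ω : E → ℝ} {f' h' : E → E} {Lf Lh μ γ η : ℝ} {x p : E}
    (hf : ∀ x, HasGradientAt f (f' x) x) (hf_lip : ∀ x y, ‖f' x - f' y‖ ≤ Lf * ‖x - y‖)
    (hμ : 0 ≤ μ) (hf_sc : StrongConvexOn Set.univ μ f)
    (hh : ∀ x, HasGradientAt h (h' x) x) (hh_lip : ∀ x y, ‖h' x - h' y‖ ≤ Lh * ‖x - y‖)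
    (hh_conv : ConvexOn ℝ Set.univ h) (hω : ConvexOn ℝ Set.univ ω)
    (hγ : 0 < γ) (hη : 0 ≤ η) (hstep : Lh + η * Lf ≤ 1 / γ)
    (hp : ∀ u, ω p + 1 / (2 * γ) * ‖p - (x - γ • (h' x + η • f' x))‖ ^ 2
      ≤ ω u + 1 / (2 * γ) * ‖u - (x - γ • (h' x + η • f' x))‖ ^ 2) (u : E) :
    h p + η * f p + ω p + 1 / (2 * γ) * ‖p - u‖ ^ 2
      ≤ h u + η * f u + ω u + 1 / (2 * γ) * ((1 - η * γ * μ) * ‖x - u‖ ^ 2) := by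
  have hf_conv : ConvexOn ℝ Set.univ f := UniformConvexOn.convexOn hf_sc fun r ↦ by
    dsimp; positivity
  have hprox := ((strongConvexOn_const_mul_norm_sub_sq (1 / (2 * γ))
    (x - γ • (h' x + η • f' x))).add_convexOn hω).quadratic_growth (x := p)
    (fun y ↦ by simpa [add_comm] using hp y) u
  have hh_up := le_add_inner_gradient_add_sq hh hh_lip x p
  have hf_up := mul_le_mul_of_nonneg_left (le_add_inner_gradient_add_sq hf hf_lip x p) hη
  have hh_low := hh_conv.add_inner_gradient_le (hh x) u
  have hf_low := mul_le_mul_of_nonneg_left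
    (hf_sc.quadratic_lower_bound (hf_conv.add_inner_gradient_le (hf x)) u) hη
  have hexp : ∀ y : E, 1 / (2 * γ) * ‖y - (x - γ • (h' x + η • f' x))‖ ^ 2
      = 1 / (2 * γ) * ‖y - x‖ ^ 2 + (⟪h' x, y - x⟫ + η * ⟪f' x, y - x⟫)
        + 1 / (2 * γ) * ‖γ • (h' x + η • f' x)‖ ^ 2 := by
    intro y
    rw [show y - (x - γ • (h' x + η • f' x)) = (y - x) + γ • (h' x + η • f' x) by abel,
      norm_add_sq_real, inner_smul_right, inner_add_right, inner_smul_right,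
      real_inner_comm (h' x), real_inner_comm (f' x)]
    field_simp
  have hsmooth := mul_le_mul_of_nonneg_right hstep (sq_nonneg ‖p - x‖)
  simp only [Pi.add_apply, hexp] at hprox
  rw [norm_sub_rev p u, norm_sub_rev x u]
  have h₁ : 1 / (2 * γ) * ((1 - η * γ * μ) * ‖u - x‖ ^ 2)
      = 1 / (2 * γ) * ‖u - x‖ ^ 2 - η * (μ / 2 * ‖u - x‖ ^ 2) := by
    field_simp
  have h₂ : 1 / γ * ‖p - x‖ ^ 2 = 2 * (1 / (2 * γ) * ‖p - x‖ ^ 2) := by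
    field_simp
  have h₃ : 2 * (1 / (2 * γ)) / 2 * ‖u - p‖ ^ 2 = 1 / (2 * γ) * ‖u - p‖ ^ 2 := by ring
  linarith

end FirstOrder

theorem ConvexOn.map_average_range_le {E : Type*} [AddCommGroup E] [Module ℝ E] {φ : E → ℝ}
    (hφ : ConvexOn ℝ Set.univ φ) (x : ℕ → E) {K : ℕ} (hK : K ≠ 0) :
    (K : ℝ) * φ ((K : ℝ)⁻¹ • ∑ k ∈ Finset.range K, x k) ≤ ∑ k ∈ Finset.range K, φ (x k) := by
  have hK' : (K : ℝ) ≠ 0 := Nat.cast_ne_zero.2 hK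
  have h := hφ.map_sum_le (t := Finset.range K) (w := fun _ ↦ (K : ℝ)⁻¹) (p := x)
    (fun _ _ ↦ by positivity) (by simp [hK']) (fun _ _ ↦ Set.mem_univ _)
  rw [← Finset.smul_sum, ← Finset.smul_sum, smul_eq_mul] at h
  have := mul_le_mul_of_nonneg_left h (Nat.cast_nonneg (α := ℝ) K)
  rwa [mul_inv_cancel_left₀ hK'] at this

theorem Antitone.sum_mul_sub_succ_le {η A : ℕ → ℝ} (hη : Antitone η) (hη₀ : ∀ k, 0 ≤ η k)
    (hA : ∀ k, 0 ≤ A k) (K : ℕ) :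
    ∑ k ∈ Finset.range K, η k * (A k - A (k + 1)) ≤ η 0 * A 0 := by
  have key : ∑ k ∈ Finset.range K, η k * (A k - A (k + 1)) ≤ η 0 * A 0 - η K * A K := by
    induction K with
    | zero => simp
    | succ K ih =>
      rw [Finset.sum_range_succ]
      nlinarith [mul_le_mul_of_nonneg_right (hη K.le_succ) (hA (K + 1))]
  linarith [mul_nonneg (hη₀ K) (hA K)]

theorem sum_one_div_add_le_log {a : ℝ} (ha : 1 ≤ a) {K : ℕ} (hK : 1 ≤ K) :
    ∑ k ∈ Finset.range K, 1 / (a + k) ≤ a + Real.log ((K + a - 1) / a) := by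
  have ha₀ : 0 < a := by linarith
  induction K, hK using Nat.le_induction with
  | base =>
    have : 1 / a ≤ a := by rw [div_le_iff₀ ha₀]; nlinarith
    simpa [ha₀.ne'] using this
  | succ K hK ih =>
    have hK₁ : (1 : ℝ) ≤ K := by exact_mod_cast hK
    have hpos : 0 < (K : ℝ) + a - 1 := by linarith
    have hpos' : 0 < a + (K : ℝ) := by linarith
    rw [Finset.sum_range_succ]
    have hlog := Real.one_sub_inv_le_log_of_pos (div_pos hpos' hpos)
    have h₁ : 1 - ((a + K) / ((K : ℝ) + a - 1))⁻¹ = 1 / (a + K) := by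
      rw [inv_div]
      field_simp
      ring
    rw [h₁, Real.log_div hpos'.ne' hpos.ne'] at hlog
    rw [Real.log_div hpos.ne' ha₀.ne'] at ih
    rw [Nat.cast_add_one, show (K : ℝ) + 1 + a - 1 = a + K by ring,
      Real.log_div hpos'.ne' ha₀.ne']
    linarith

theorem neg_inner_le_norm_mul_infDist {E : Type*} [NormedAddCommGroup E] [InnerProductSpace ℝ E]
    {X : Set E} (hX : X.Nonempty) {g x₀ : E} (hg : ∀ y ∈ X, (0 : ℝ) ≤ ⟪g, y - x₀⟫) (z : E) :
    -⟪g, z - x₀⟫ ≤ ‖g‖ * infDist z X := by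
  refine le_of_forall_pos_le_add fun ε hε ↦ ?_
  have hg₁ : 0 < ‖g‖ + 1 := by positivity
  obtain ⟨y, hy, hzy⟩ := (infDist_lt_iff hX).1 (lt_add_of_pos_right (infDist z X)
    (div_pos hε hg₁))
  have h₁ : ⟪g, y - z⟫ ≤ ‖g‖ * dist z y := by
    rw [dist_comm, dist_eq_norm]
    exact real_inner_le_norm _ _
  have h₂ : ⟪g, y - x₀⟫ = ⟪g, y - z⟫ + ⟪g, z - x₀⟫ := by
    rw [← inner_add_right, sub_add_sub_cancel]
  have h₃ := mul_le_mul_of_nonneg_left hzy.le (norm_nonneg g)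
  have h₄ : ‖g‖ * (ε / (‖g‖ + 1)) ≤ ε := by
    rw [mul_div_assoc', div_le_iff₀ hg₁]
    linarith
  linarith [hg y hy]

theorem stmt_14
    {n : ℕ}
    (f h ωf ωh : EuclideanSpace ℝ (Fin n) → ℝ)
    (f' h' : EuclideanSpace ℝ (Fin n) → EuclideanSpace ℝ (Fin n))
    (Lf Lh μf : ℝ)
    (hμf_pos : 0 < μf) (hμf_le : μf ≤ Lf) (hLh_pos : 0 < Lh)
    (hf_grad : ∀ x, HasGradientAt f (f' x) x)
    (hf_lip : ∀ x y, ‖f' x - f' y‖ ≤ Lf * ‖x - y‖)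
    (hf_sc : StrongConvexOn Set.univ μf f)
    (hh_grad : ∀ x, HasGradientAt h (h' x) x)
    (hh_lip : ∀ x y, ‖h' x - h' y‖ ≤ Lh * ‖x - y‖)
    (hh_conv : ConvexOn ℝ Set.univ h)
    (hωf_conv : ConvexOn ℝ Set.univ ωf)
    (hωh_conv : ConvexOn ℝ Set.univ ωh)
    (fbar hbar : EuclideanSpace ℝ (Fin n) → ℝ)
    (hfbar : ∀ x, fbar x = f x + ωf x)
    (hhbar : ∀ x, hbar x = h x + ωh x)
    (X : Set (EuclideanSpace ℝ (Fin n)))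
    (hX : X = {z | ∀ y, hbar z ≤ hbar y})
    (hXne : X.Nonempty)
    (hstar : ℝ)
    (hhstar : IsGLB (Set.range hbar) hstar)
    (xstar : EuclideanSpace ℝ (Fin n))
    (hxstar_mem : xstar ∈ X)
    (hxstar_min : ∀ y ∈ X, fbar xstar ≤ fbar y)
    (g : EuclideanSpace ℝ (Fin n))
    (hg_sub : ∀ y, fbar xstar + ⟪g, y - xstar⟫ ≤ fbar y)
    (hg_opt : ∀ y ∈ X, (0:ℝ) ≤ ⟪g, y - xstar⟫)
    (Cf : ℝ)
    (hCf : IsGLB (Set.range fbar) Cf)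
    (x : ℕ → EuclideanSpace ℝ (Fin n))
    (η : ℕ → ℝ) (γ : ℝ)
    (hγ_pos : 0 < γ)
    (hμ2 : μf < 2 * Lf)
    (hγ_le : γ ≤ 1 / (2 * Lh))
    (η0u η0l : ℝ)
    (hη0u : η0u = 1 / (γ * μf))
    (hη0l : η0l = 2 * Lf / μf)
    (hη : ∀ k : ℕ, η k = η0u / (η0l + (k : ℝ)))
    (hx_iter : ∀ k u,
      ωh (x (k+1)) + η k * ωf (x (k+1))
        + 1 / (2*γ) * ‖x (k+1) - (x k - γ • (h' (x k) + η k • f' (x k)))‖ ^ 2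
      ≤ ωh u + η k * ωf u
        + 1 / (2*γ) * ‖u - (x k - γ • (h' (x k) + η k • f' (x k)))‖ ^ 2)
    (θ : ℕ → ℝ)
    (hθ : ∀ k, θ k = 1 / ∏ t ∈ Finset.range (k+1), (1 - η t * γ * μf))
    (xbar : ℕ → EuclideanSpace ℝ (Fin n))
    (hxbar : ∀ K, xbar K = (∑ j ∈ Finset.range K, θ j * η j)⁻¹ •
        ∑ k ∈ Finset.range K, (θ k * η k) • x (k+1))
    (α m : ℝ) (hα : 0 < α) (hm : 1 ≤ m)
    (hws : ∀ z, α * Metric.infDist z X ^ m ≤ hbar z - hstar) :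
    ∀ K : ℕ, 1 ≤ K →
      ‖xbar K - xstar‖ ^ 2
        ≤ 2 * ((2 * Lf - μf) / 2 * ‖x 0 - xstar‖ ^ 2) / (μf * K)
          + 2 * ‖g‖ / μf *
            ((γ * (2 * Lf - μf) * (η 0 * ‖x 0 - xstar‖ ^ 2 / (2 * γ)
                  + (fbar xstar - Cf) * (η0u ^ 2 / (η0l - 1))
                    * (η0l + Real.log (((K : ℝ) + η0l - 1) / η0l))))
              / (α * K)) ^ (1 / m) := by
  intro K hK
  have hK₀ : (0 : ℝ) < K := by exact_mod_cast hK
  have hη0u_pos : 0 < η0u := by rw [hη0u]; positivity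
  have hη0l_ge : 2 ≤ η0l := by rw [hη0l, le_div_iff₀ hμf_pos]; linarith
  have hden : ∀ k : ℕ, 0 < η0l + (k : ℝ) := fun k ↦ by positivity
  have hden' : ∀ k : ℕ, 0 < η0l + (k : ℝ) - 1 := fun k ↦ by
    have := Nat.cast_nonneg (α := ℝ) k
    linarith
  have hη_pos : ∀ k, 0 < η k := fun k ↦ by rw [hη]; exact div_pos hη0u_pos (hden k)
  have hη_mul : ∀ k, (η0l + k) * η k = η0u := fun k ↦ by
    rw [hη, mul_div_cancel₀ _ (hden k).ne']
  have hη_anti : Antitone η := fun i j hij ↦ by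
    rw [hη, hη]
    have : (i : ℝ) ≤ j := by exact_mod_cast hij
    exact div_le_div_of_nonneg_left hη0u_pos.le (hden i) (by linarith)
  have hη0u_mul : η0u * (γ * μf) = 1 := by rw [hη0u]; field_simp
  have hcontr : ∀ k, (η0l + k) * (1 - η k * γ * μf) = η0l + k - 1 := fun k ↦ by
    linear_combination (-(γ * μf)) * hη_mul k - hη0u_mul
  have hscale : η0l - 1 = η0u * (γ * (2 * Lf - μf)) := by
    rw [hη0l, hη0u]; field_simp
  have hstep : ∀ k, Lh + η k * Lf ≤ 1 / γ := fun k ↦ by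
    have h₁ : η k * Lf ≤ η 0 * Lf :=
      mul_le_mul_of_nonneg_right (hη_anti k.zero_le) (by linarith)
    have h₂ : η 0 * Lf = 1 / (2 * γ) := by
      have hLf : Lf ≠ 0 := by linarith
      rw [hη, hη0u, hη0l, Nat.cast_zero, add_zero]
      field_simp
    have h₃ : Lh ≤ 1 / (2 * γ) := by
      rw [le_div_iff₀ (by positivity)] at hγ_le ⊢
      linarith
    have h₄ : 1 / γ = 1 / (2 * γ) + 1 / (2 * γ) := by field_simp; norm_num
    linarith
  have hθη : ∀ k, θ k * η k = η0u / (η0l - 1) := fun k ↦ by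
    have hprod : (∏ t ∈ Finset.range (k + 1), (1 - η t * γ * μf)) * (η0l + k) = η0l - 1 := by
      induction k with
      | zero =>
        have := hcontr 0
        rw [Nat.cast_zero, add_zero] at *
        simpa [mul_comm] using this
      | succ k ih =>
        rw [Finset.prod_range_succ, mul_assoc, mul_comm (1 - _), hcontr, ← ih]
        push_cast
        ring
    have hne : η0l - 1 ≠ 0 := by linarith
    have hprod_ne := left_ne_zero_of_mul (hprod.trans_ne hne)
    rw [hθ, one_div_mul_eq_div, div_eq_div_iff hprod_ne hne]
    linear_combination (-η k) * hprod
      + (∏ t ∈ Finset.range (k + 1), (1 - η t * γ * μf)) * hη_mul k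
  have hxbar_eq : xbar K = (K : ℝ)⁻¹ • ∑ k ∈ Finset.range K, x (k + 1) := by
    have hne : η0u / (η0l - 1) ≠ 0 := (div_pos hη0u_pos (by linarith)).ne'
    rw [hxbar]
    simp only [hθη]
    rw [← Finset.smul_sum, smul_smul, Finset.sum_const, Finset.card_range, nsmul_eq_mul, mul_inv,
      inv_mul_cancel_right₀ hne]
  have hf_conv : ConvexOn ℝ Set.univ f := UniformConvexOn.convexOn hf_sc fun r ↦ by
    dsimp; positivity
  have hfbar_eq : fbar = f + ωf := funext hfbar
  have hhbar_eq : hbar = h + ωh := funext hhbar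
  have hfbar_sc : StrongConvexOn Set.univ μf fbar := hfbar_eq ▸ hf_sc.add_convexOn hωf_conv
  have hfbar_conv : ConvexOn ℝ Set.univ fbar := hfbar_eq ▸ hf_conv.add hωf_conv
  have hhbar_conv : ConvexOn ℝ Set.univ hbar := hhbar_eq ▸ hh_conv.add hωh_conv
  have hxstar_le : ∀ y, hbar xstar ≤ hbar y := by rw [hX] at hxstar_mem; exact hxstar_mem
  have hstar_eq : hbar xstar = hstar := by
    refine IsLeast.isGLB ⟨Set.mem_range_self _, ?_⟩ |>.unique hhstar
    rintro _ ⟨y, rfl⟩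
    exact hxstar_le y
  set A : ℕ → ℝ := fun k ↦ (η0l + k - 1) * ‖x k - xstar‖ ^ 2 with hA
  have hA_nonneg : ∀ k, 0 ≤ A k := fun k ↦ mul_nonneg (hden' k).le (sq_nonneg _)
  have hA₀ : A 0 = (η0l - 1) * ‖x 0 - xstar‖ ^ 2 := by simp [hA]
  have hrec : ∀ k, η0u * (fbar (x (k + 1)) - fbar xstar)
      + (η0l + k) * (hbar (x (k + 1)) - hstar) ≤ 1 / (2 * γ) * (A k - A (k + 1)) := fun k ↦ by
    have h₁ := proximal_gradient_step (ω := fun u ↦ ωh u + η k * ωf u) hf_grad hf_lip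
      hμf_pos.le hf_sc hh_grad hh_lip hh_conv
      (hωh_conv.add (hωf_conv.smul (hη_pos k).le)) hγ_pos (hη_pos k).le (hstep k)
      (hx_iter k) xstar
    have h₂ := mul_le_mul_of_nonneg_left h₁ (hden k).le
    rw [← hstar_eq]
    simp only [hA, hfbar, hhbar, Nat.cast_add_one]
    linear_combination h₂ - (f (x (k + 1)) + ωf (x (k + 1)) - f xstar - ωf xstar) * hη_mul k
      + 1 / (2 * γ) * ‖x k - xstar‖ ^ 2 * hcontr k
  have hgap : ∀ k, 0 ≤ hbar (x (k + 1)) - hstar := fun k ↦ by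
    rw [← hstar_eq]; exact sub_nonneg.2 (hxstar_le _)
  have hCf_le : ∀ y, Cf ≤ fbar y := fun y ↦ hCf.1 (Set.mem_range_self y)
  have houter : fbar (xbar K) - fbar xstar ≤ (2 * Lf - μf) / 2 * ‖x 0 - xstar‖ ^ 2 / K := by
    have h₁ := hfbar_conv.map_average_range_le (fun k ↦ x (k + 1)) (K := K) (by omega)
    rw [← hxbar_eq] at h₁
    have h₂ : η0u * ∑ k ∈ Finset.range K, (fbar (x (k + 1)) - fbar xstar)
        ≤ 1 / (2 * γ) * A 0 := by
      calc _ = ∑ k ∈ Finset.range K, η0u * (fbar (x (k + 1)) - fbar xstar) := Finset.mul_sum ..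
        _ ≤ ∑ k ∈ Finset.range K, 1 / (2 * γ) * (A k - A (k + 1)) :=
          Finset.sum_le_sum fun k _ ↦ by
            linarith [hrec k, mul_nonneg (hden k).le (hgap k)]
        _ = 1 / (2 * γ) * (A 0 - A K) := by
          rw [← Finset.mul_sum, Finset.sum_range_sub']
        _ ≤ _ := mul_le_mul_of_nonneg_left (sub_le_self _ (hA_nonneg K)) (by positivity)
    have h₃ : 1 / (2 * γ) * A 0 = η0u * ((2 * Lf - μf) / 2 * ‖x 0 - xstar‖ ^ 2) := by
      rw [hA₀, hscale]; field_simp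
    rw [h₃] at h₂
    have h₄ := le_of_mul_le_mul_left h₂ hη0u_pos
    rw [Finset.sum_sub_distrib, Finset.sum_const, Finset.card_range, nsmul_eq_mul] at h₄
    rw [le_div_iff₀ hK₀]
    linarith
  set U := γ * (2 * Lf - μf) * (η 0 * ‖x 0 - xstar‖ ^ 2 / (2 * γ)
    + (fbar xstar - Cf) * (η0u ^ 2 / (η0l - 1))
      * (η0l + Real.log (((K : ℝ) + η0l - 1) / η0l))) with hU
  have hinner : hbar (xbar K) - hstar ≤ U / K := by
    have h₁ := hhbar_conv.map_average_range_le (fun k ↦ x (k + 1)) (K := K) (by omega)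
    rw [← hxbar_eq] at h₁
    have h₂ : ∀ k, η0u * (hbar (x (k + 1)) - hstar)
        ≤ 1 / (2 * γ) * (η k * (A k - A (k + 1)))
          + (fbar xstar - Cf) * η0u ^ 2 * (1 / (η0l + k)) := fun k ↦ by
      have h₃ := mul_le_mul_of_nonneg_left (hrec k) (hη_pos k).le
      have h₄ := mul_le_mul_of_nonneg_left (hCf_le (x (k + 1)))
        (mul_pos hη0u_pos (hη_pos k)).le
      have h₅ : η0u ^ 2 * (1 / (η0l + k)) = η0u * η k := by rw [hη]; ring
      linear_combination h₃ + h₄ - (hbar (x (k + 1)) - hstar) * hη_mul k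
        - (fbar xstar - Cf) * h₅
    have h₃ := Finset.sum_le_sum fun k (_ : k ∈ Finset.range K) ↦ h₂ k
    rw [Finset.sum_add_distrib, ← Finset.mul_sum, ← Finset.mul_sum, ← Finset.mul_sum,
      Finset.sum_sub_distrib, Finset.sum_const, Finset.card_range, nsmul_eq_mul] at h₃
    have h₄ := mul_le_mul_of_nonneg_left
      (hη_anti.sum_mul_sub_succ_le (fun k ↦ (hη_pos k).le) hA_nonneg K)
      (show 0 ≤ 1 / (2 * γ) by positivity)
    have h₅ := mul_le_mul_of_nonneg_left (sum_one_div_add_le_log (a := η0l) (by linarith) hK)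
      (mul_nonneg (sub_nonneg.2 (hCf_le xstar)) (sq_nonneg η0u))
    have h₆ : η0u * U = 1 / (2 * γ) * (η 0 * A 0) + (fbar xstar - Cf) * η0u ^ 2
        * (η0l + Real.log (((K : ℝ) + η0l - 1) / η0l)) := by
      have hne : η0l - 1 ≠ 0 := by linarith
      rw [hU, ← mul_assoc, ← hscale, hA₀]
      field_simp
    have h₇ : η0u * (K * (hbar (xbar K) - hstar)) ≤ η0u * U := by
      rw [h₆]
      have := mul_le_mul_of_nonneg_left h₁ hη0u_pos.le
      linarith
    rw [le_div_iff₀ hK₀]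
    linarith [le_of_mul_le_mul_left h₇ hη0u_pos]
  have hdist : infDist (xbar K) X ≤ (U / (α * K)) ^ (1 / m) := by
    have h₁ : infDist (xbar K) X ^ m ≤ U / (α * K) := by
      rw [mul_comm α, ← div_div, le_div_iff₀ hα, mul_comm]
      exact (hws _).trans hinner
    calc infDist (xbar K) X = (infDist (xbar K) X ^ m) ^ (1 / m) := by
          rw [one_div, Real.rpow_rpow_inv infDist_nonneg (by linarith)]
      _ ≤ _ := Real.rpow_le_rpow (Real.rpow_nonneg infDist_nonneg _) h₁ (by positivity)
  have h₁ := hfbar_sc.quadratic_lower_bound hg_sub (xbar K)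
  have h₂ := (neg_inner_le_norm_mul_infDist hXne hg_opt (xbar K)).trans
    (mul_le_mul_of_nonneg_left hdist (norm_nonneg g))
  have h₃ : μf / 2 * ‖xbar K - xstar‖ ^ 2 ≤ (2 * Lf - μf) / 2 * ‖x 0 - xstar‖ ^ 2 / K
      + ‖g‖ * (U / (α * K)) ^ (1 / m) := by linarith
  have h₄ : ‖xbar K - xstar‖ ^ 2 = 2 / μf * (μf / 2 * ‖xbar K - xstar‖ ^ 2) := by field_simp
  rw [h₄]
  refine (mul_le_mul_of_nonneg_left h₃ (by positivity)).trans_eq ?_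
  field_simp
end
end

section
/- Let p > 0, let K > 1 be an integer with K/ln(K) ≥ 2(p+1)L_f/μ_f, let γ ≤ 1/(2L_h), and run IR-ISTA with the constant regularization parameter η := (p+1)ln(K)/(γμ_f K) (so γ ≤ 1/(L_h + ηL_f)). Then: −‖∇̃f̄(x*)‖·dist(x̄_K, X*_h̄) + (μ_f/2)‖x̄_K − x*‖² ≤ f̄(x̄_K) − f̄* ≤ u_3/(ln(K)·K^p), where u_3 := μ_f‖x_0 − x*‖²/(2(p+1)). -/
open scoped RealInnerProductSpace
open Metric Filter

noncomputable section

section ConvexAnalysis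

variable {E : Type*} [NormedAddCommGroup E] [InnerProductSpace ℝ E]

lemma le_of_forall_le_add_mul {a b c : ℝ}
    (h : ∀ t : ℝ, 0 < t → t ≤ 1 → a ≤ b + t * c) : a ≤ b := by
  by_contra! hlt
  have hc : 0 < 2 * (|c| + 1) := by positivity
  have ht : 0 < min 1 ((a - b) / (2 * (|c| + 1))) := by
    apply lt_min one_pos
    exact div_pos (by linarith) hc
  have hle := h _ ht (min_le_left _ _)
  have h1 : min 1 ((a - b) / (2 * (|c| + 1))) * c
      ≤ (a - b) / (2 * (|c| + 1)) * (|c| + 1) :=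
    (mul_le_mul_of_nonneg_left (by linarith [le_abs_self c]) ht.le).trans
      (mul_le_mul_of_nonneg_right (min_le_right _ _) (by positivity))
  have h2 : (a - b) / (2 * (|c| + 1)) * (|c| + 1) = (a - b) / 2 := by
    field_simp
  linarith

/-- An affine minorant of a strongly convex function improves to a quadratic minorant. -/
lemma StrongConvexOn.add_inner_add_sq_le {f : E → ℝ} {m : ℝ}
    (hf : StrongConvexOn Set.univ m f) {x g : E}
    (hg : ∀ y, f x + ⟪g, y - x⟫ ≤ f y) (y : E) :
    f x + ⟪g, y - x⟫ + m / 2 * ‖y - x‖ ^ 2 ≤ f y := by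
  suffices h : ⟪g, y - x⟫ ≤ f y - f x - m / 2 * ‖y - x‖ ^ 2 by linarith
  refine le_of_forall_le_add_mul (c := m / 2 * ‖y - x‖ ^ 2) fun t ht0 ht1 => ?_
  have h1 := hf.2 (Set.mem_univ x) (Set.mem_univ y) (sub_nonneg.2 ht1) ht0.le (by ring)
  have h2 := hg ((1 - t) • x + t • y)
  have h3 : (1 - t) • x + t • y - x = t • (y - x) := by module
  rw [h3, real_inner_smul_right] at h2
  simp only [smul_eq_mul] at h1
  rw [norm_sub_rev x y] at h1
  refine le_of_mul_le_mul_left ?_ ht0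
  linarith

/-- The optimality condition of a proximal step. -/
lemma ConvexOn.sub_le_inner_of_isMin_prox {ω : E → ℝ} (hω : ConvexOn ℝ Set.univ ω) {c : ℝ}
    {p v : E} (hp : ∀ u, ω p + c * ‖p - v‖ ^ 2 ≤ ω u + c * ‖u - v‖ ^ 2) (u : E) :
    ω p - ω u ≤ 2 * c * ⟪p - v, u - p⟫ := by
  refine le_of_forall_le_add_mul (c := c * ‖u - p‖ ^ 2) fun t ht0 ht1 => ?_
  have h1 := hω.2 (Set.mem_univ p) (Set.mem_univ u) (sub_nonneg.2 ht1) ht0.le (by ring)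
  have h2 := hp ((1 - t) • p + t • u)
  have h3 : (1 - t) • p + t • u - v = (p - v) + t • (u - p) := by module
  rw [h3, norm_add_sq_real, real_inner_smul_right, norm_smul, mul_pow, Real.norm_eq_abs,
    sq_abs] at h2
  simp only [smul_eq_mul] at h1
  refine le_of_mul_le_mul_left ?_ ht0
  linarith

lemma HasGradientAt.hasDerivAt_add_smul [CompleteSpace E] {f : E → ℝ} {g x d : E} {t : ℝ}
    (hf : HasGradientAt f g (x + t • d)) :
    HasDerivAt (fun s : ℝ => f (x + s • d)) ⟪g, d⟫ t := by
  have hline : HasDerivAt (fun s : ℝ => x + s • d) d t := by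
    simpa using ((hasDerivAt_id t).smul_const d).const_add x
  exact (hf.hasFDerivAt.comp_hasDerivAt t hline).congr_deriv (by simp)

lemma ConvexOn.add_inner_le_of_hasGradientAt [CompleteSpace E] {f : E → ℝ}
    (hf : ConvexOn ℝ Set.univ f) {x g : E} (hg : HasGradientAt f g x) (y : E) :
    f x + ⟪g, y - x⟫ ≤ f y := by
  have hconv : ConvexOn ℝ Set.univ (fun s : ℝ => f (x + s • (y - x))) := by
    refine ⟨convex_univ, fun s _ t _ a b ha hb hab => ?_⟩
    have h := hf.2 (Set.mem_univ (x + s • (y - x))) (Set.mem_univ (x + t • (y - x))) ha hb hab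
    convert h using 2
    obtain rfl : b = 1 - a := by linarith
    simp only [smul_eq_mul]
    module
  have hder : HasDerivAt (fun s : ℝ => f (x + s • (y - x))) ⟪g, y - x⟫ 0 :=
    HasGradientAt.hasDerivAt_add_smul (by simpa using hg)
  have h := hconv.le_slope_of_hasDerivAt (Set.mem_univ 0) (Set.mem_univ 1) one_pos hder
  simp [slope_def_field] at h
  linarith

/-- The descent lemma. -/
lemma le_add_inner_add_sq_of_lipschitz_gradient [CompleteSpace E] {f : E → ℝ} {f' : E → E}
    {L : ℝ} (hf : ∀ x, HasGradientAt f (f' x) x) (hL : ∀ x y, ‖f' x - f' y‖ ≤ L * ‖x - y‖)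
    (x y : E) : f y ≤ f x + ⟪f' x, y - x⟫ + L / 2 * ‖y - x‖ ^ 2 := by
  set d := y - x with hd
  have hder : ∀ t : ℝ, HasDerivAt
      (fun s : ℝ => f (x + s • d) - (s * ⟪f' x, d⟫ + s ^ 2 * (L / 2 * ‖d‖ ^ 2)))
      (⟪f' (x + t • d), d⟫ - (⟪f' x, d⟫ + t * (L * ‖d‖ ^ 2))) t := fun t => by
    have h1 := (hasDerivAt_id t).mul_const ⟪f' x, d⟫
    have h2 := (hasDerivAt_pow 2 t).mul_const (L / 2 * ‖d‖ ^ 2)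
    refine ((hf (x + t • d)).hasDerivAt_add_smul.sub (h1.add h2)).congr_deriv ?_
    norm_num
    ring
  have hanti : AntitoneOn
      (fun s : ℝ => f (x + s • d) - (s * ⟪f' x, d⟫ + s ^ 2 * (L / 2 * ‖d‖ ^ 2)))
      (Set.Icc 0 1) := by
    refine antitoneOn_of_hasDerivWithinAt_nonpos (convex_Icc 0 1)
      (fun t _ => (hder t).continuousAt.continuousWithinAt)
      (fun t _ => (hder t).hasDerivWithinAt) fun t ht => ?_
    have ht0 : 0 ≤ t := (interior_subset ht).1
    have h1 := hL (x + t • d) x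
    rw [add_sub_cancel_left, norm_smul, Real.norm_of_nonneg ht0] at h1
    have h2 := real_inner_le_norm (f' (x + t • d) - f' x) d
    rw [inner_sub_left] at h2
    nlinarith [mul_le_mul_of_nonneg_right h1 (norm_nonneg d)]
  have h := hanti (Set.left_mem_Icc.2 zero_le_one) (Set.right_mem_Icc.2 zero_le_one) zero_le_one
  simp [hd] at h
  linarith

/-- One proximal gradient step on `φ + ω`, where `φ` has a quadratic upper model with constant
`1 / γ` and a quadratic lower model with constant `m`. -/
lemma proximal_gradient_step_s15 {φ ω : E → ℝ} {G x p : E} {γ m : ℝ} (hγ : 0 < γ)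
    (hω : ConvexOn ℝ Set.univ ω)
    (hup : φ p ≤ φ x + ⟪G, p - x⟫ + 1 / (2 * γ) * ‖p - x‖ ^ 2)
    (hp : ∀ u, ω p + 1 / (2 * γ) * ‖p - (x - γ • G)‖ ^ 2
      ≤ ω u + 1 / (2 * γ) * ‖u - (x - γ • G)‖ ^ 2)
    (u : E) (hlow : φ x + ⟪G, u - x⟫ + m / 2 * ‖u - x‖ ^ 2 ≤ φ u) :
    φ p + ω p - (φ u + ω u)
      ≤ 1 / (2 * γ) * ((1 - γ * m) * ‖x - u‖ ^ 2 - ‖p - u‖ ^ 2) := by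
  have h1 := hω.sub_le_inner_of_isMin_prox hp u
  have e1 : p - (x - γ • G) = (p - x) + γ • G := by module
  have e2 : u - x = (u - p) + (p - x) := by module
  have e3 : ‖u - x‖ ^ 2 = ‖u - p‖ ^ 2 + 2 * ⟪p - x, u - p⟫ + ‖p - x‖ ^ 2 := by
    rw [e2, norm_add_sq_real, real_inner_comm]
  have e4 : ⟪G, u - x⟫ = ⟪G, u - p⟫ + ⟪G, p - x⟫ := by rw [e2, inner_add_right]
  rw [e1, inner_add_left, real_inner_smul_left] at h1
  rw [norm_sub_rev x u, norm_sub_rev p u]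
  have e5 : 2 * (1 / (2 * γ)) * (⟪p - x, u - p⟫ + γ * ⟪G, u - p⟫)
      = 1 / (2 * γ) * (2 * ⟪p - x, u - p⟫) + ⟪G, u - p⟫ := by
    field_simp
  have e6 : 1 / (2 * γ) * ((1 - γ * m) * ‖u - x‖ ^ 2 - ‖u - p‖ ^ 2)
      = 1 / (2 * γ) * (‖u - x‖ ^ 2 - ‖u - p‖ ^ 2) - m / 2 * ‖u - x‖ ^ 2 := by
    field_simp
    ring
  rw [e5] at h1
  rw [e6]
  have e7 : 1 / (2 * γ) * (‖u - x‖ ^ 2 - ‖u - p‖ ^ 2)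
      = 1 / (2 * γ) * (2 * ⟪p - x, u - p⟫) + 1 / (2 * γ) * ‖p - x‖ ^ 2 := by
    rw [e3]
    ring
  linarith

lemma neg_norm_mul_infDist_le_inner {X : Set E} {g z : E} (hX : X.Nonempty)
    (hg : ∀ y ∈ X, 0 ≤ ⟪g, y - z⟫) (y : E) :
    -‖g‖ * infDist y X ≤ ⟪g, y - z⟫ := by
  suffices h : -⟪g, y - z⟫ ≤ ‖g‖ * infDist y X by linarith
  refine le_of_forall_le_add_mul (c := ‖g‖) fun t ht _ => ?_
  obtain ⟨w, hw, hd⟩ := (infDist_lt_iff hX).1 (lt_add_of_pos_right (infDist y X) ht)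
  have h1 := hg w hw
  have h2 : ⟪g, w - y⟫ ≤ ‖g‖ * ‖w - y‖ := real_inner_le_norm _ _
  have h3 : w - z = (w - y) + (y - z) := by module
  rw [h3, inner_add_right] at h1
  rw [dist_eq_norm, norm_sub_rev] at hd
  nlinarith [mul_le_mul_of_nonneg_left hd.le (norm_nonneg g)]

/-- Weighted telescoping for a geometrically contracting energy inequality. -/
lemma sum_inv_pow_mul_le {D e : ℕ → ℝ} {c r : ℝ} (hr : 0 < r) (hc : 0 ≤ c)
    (he : ∀ k, 0 ≤ e k) (hD : ∀ k, D k ≤ c * (r * e k - e (k + 1))) (K : ℕ) :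
    ∑ k ∈ Finset.range K, (r ^ (k + 1))⁻¹ * D k ≤ c * e 0 := by
  suffices h : ∑ k ∈ Finset.range K, (r ^ (k + 1))⁻¹ * D k ≤ c * (e 0 - (r ^ K)⁻¹ * e K) by
    have : 0 ≤ c * ((r ^ K)⁻¹ * e K) := mul_nonneg hc (mul_nonneg (by positivity) (he K))
    linarith
  induction K with
  | zero => simp
  | succ K ih =>
    rw [Finset.sum_range_succ]
    have h1 := mul_le_mul_of_nonneg_left (hD K) (inv_nonneg.2 (pow_pos hr (K + 1)).le)
    have h2 : (r ^ (K + 1))⁻¹ * (c * (r * e K - e (K + 1)))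
        = c * ((r ^ K)⁻¹ * e K - (r ^ (K + 1))⁻¹ * e (K + 1)) := by
      field_simp
      ring
    linarith

end ConvexAnalysis

lemma rpow_le_inv_one_sub_pow {a : ℝ} {K : ℕ} (hK : 0 < K) (hlt : a * Real.log K / K < 1) :
    (K : ℝ) ^ a ≤ ((1 - a * Real.log K / K) ^ K)⁻¹ := by
  have hK0 : (0 : ℝ) < K := by exact_mod_cast hK
  have h1 : (1 - a * Real.log K / K) ^ K ≤ Real.exp (-(a * Real.log K / K)) ^ K :=
    pow_le_pow_left₀ (by linarith) (by linarith [Real.add_one_le_exp (-(a * Real.log K / K))]) K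
  have h2 : Real.exp (-(a * Real.log K / K)) ^ K = ((K : ℝ) ^ a)⁻¹ := by
    rw [← Real.exp_nat_mul, Real.rpow_def_of_pos hK0, ← Real.exp_neg]
    congr 1
    field_simp
  rw [h2] at h1
  rw [le_inv_comm₀ (Real.rpow_pos_of_pos hK0 a) (pow_pos (by linarith) K)]
  exact h1

theorem stmt_15
    {n : ℕ}
    (f h ωf ωh : EuclideanSpace ℝ (Fin n) → ℝ)
    (f' h' : EuclideanSpace ℝ (Fin n) → EuclideanSpace ℝ (Fin n))
    (Lf Lh μf : ℝ)
    (hμf_pos : 0 < μf) (hμf_le : μf ≤ Lf) (hLh_pos : 0 < Lh)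
    (hf_grad : ∀ x, HasGradientAt f (f' x) x)
    (hf_lip : ∀ x y, ‖f' x - f' y‖ ≤ Lf * ‖x - y‖)
    (hf_sc : StrongConvexOn Set.univ μf f)
    (hh_grad : ∀ x, HasGradientAt h (h' x) x)
    (hh_lip : ∀ x y, ‖h' x - h' y‖ ≤ Lh * ‖x - y‖)
    (hh_conv : ConvexOn ℝ Set.univ h)
    (hωf_conv : ConvexOn ℝ Set.univ ωf)
    (hωh_conv : ConvexOn ℝ Set.univ ωh)
    (fbar hbar : EuclideanSpace ℝ (Fin n) → ℝ)
    (hfbar : ∀ x, fbar x = f x + ωf x)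
    (hhbar : ∀ x, hbar x = h x + ωh x)
    (X : Set (EuclideanSpace ℝ (Fin n)))
    (hX : X = {z | ∀ y, hbar z ≤ hbar y})
    (hXne : X.Nonempty)
    (hstar : ℝ)
    (hhstar : IsGLB (Set.range hbar) hstar)
    (xstar : EuclideanSpace ℝ (Fin n))
    (hxstar_mem : xstar ∈ X)
    (hxstar_min : ∀ y ∈ X, fbar xstar ≤ fbar y)
    (g : EuclideanSpace ℝ (Fin n))
    (hg_sub : ∀ y, fbar xstar + ⟪g, y - xstar⟫ ≤ fbar y)
    (hg_opt : ∀ y ∈ X, (0:ℝ) ≤ ⟪g, y - xstar⟫)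
    (x : ℕ → EuclideanSpace ℝ (Fin n))
    (η γ : ℝ)
    (hγ_pos : 0 < γ)
    (hx_iter : ∀ k u,
      ωh (x (k+1)) + η * ωf (x (k+1))
        + 1 / (2*γ) * ‖x (k+1) - (x k - γ • (h' (x k) + η • f' (x k)))‖ ^ 2
      ≤ ωh u + η * ωf u
        + 1 / (2*γ) * ‖u - (x k - γ • (h' (x k) + η • f' (x k)))‖ ^ 2)
    (θ : ℕ → ℝ)
    (hθ : ∀ k : ℕ, θ k = ((1 - η * γ * μf) ^ (k+1))⁻¹)
    (xbar : ℕ → EuclideanSpace ℝ (Fin n))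
    (hxbar : ∀ K, xbar K = (∑ j ∈ Finset.range K, θ j)⁻¹ •
        ∑ k ∈ Finset.range K, θ k • x (k+1))
    (p : ℝ) (hp : 0 < p)
    (K : ℕ) (hK : 1 < K)
    (hKcond : 2 * (p + 1) * Lf / μf ≤ (K : ℝ) / Real.log K)
    (hγ_le2 : γ ≤ 1 / (2 * Lh))
    (hη : η = (p + 1) * Real.log K / (γ * μf * K))
    :
    (-‖g‖ * Metric.infDist (xbar K) X + μf / 2 * ‖xbar K - xstar‖ ^ 2
        ≤ fbar (xbar K) - fbar xstar)
    ∧ fbar (xbar K) - fbar xstar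
        ≤ μf * ‖x 0 - xstar‖ ^ 2 / (2 * (p + 1)) / (Real.log K * (K : ℝ) ^ p) := by
  have hfbar' : fbar = fun z => f z + ωf z := funext hfbar
  have hhbar' : hbar = fun z => h z + ωh z := funext hhbar
  have hf_conv : ConvexOn ℝ Set.univ f :=
    UniformConvexOn.convexOn hf_sc fun r => by simp only [Pi.zero_apply]; positivity
  have hfbar_sc : StrongConvexOn Set.univ μf fbar := by
    have := UniformConvexOn.add hf_sc (uniformConvexOn_zero.2 hωf_conv)
    rw [add_zero] at this
    rw [hfbar']
    exact this
  refine ⟨?_, ?_⟩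
  · have h1 := hfbar_sc.add_inner_add_sq_le hg_sub (xbar K)
    have h2 := neg_norm_mul_infDist_le_inner hXne hg_opt (xbar K)
    linarith
  have hK1 : (1 : ℝ) < K := by exact_mod_cast hK
  have hK0 : (0 : ℝ) < K := by linarith
  have hlog : 0 < Real.log K := Real.log_pos hK1
  have hLf : 0 < Lf := hμf_pos.trans_le hμf_le
  have hη_pos : 0 < η := by rw [hη]; positivity
  have hq : η * γ * μf = (p + 1) * Real.log K / K := by
    rw [hη]
    field_simp
  have hηLf : 2 * (γ * (η * Lf)) ≤ 1 := by
    have h1 : 2 * (γ * (η * Lf)) = (2 * (p + 1) * Lf / μf) * (Real.log K / K) := by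
      rw [hη]
      field_simp
    have h2 := mul_le_mul_of_nonneg_right hKcond (div_pos hlog hK0).le
    have h3 : (K : ℝ) / Real.log K * (Real.log K / K) = 1 := by field_simp
    linarith
  have hq1 : η * γ * μf < 1 := by
    have : η * γ * μf ≤ γ * (η * Lf) := by
      nlinarith [mul_le_mul_of_nonneg_left hμf_le (mul_pos hη_pos hγ_pos).le]
    linarith
  have hstep_le : Lh + η * Lf ≤ 1 / γ := by
    rw [le_div_iff₀ (by positivity)] at hγ_le2 ⊢
    linarith
  have hω_conv : ConvexOn ℝ Set.univ (fun z => ωh z + η * ωf z) :=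
    hωh_conv.add (hωf_conv.smul hη_pos.le)
  have hφ_grad : ∀ z, HasGradientAt (fun z => h z + η * f z) (h' z + η • f' z) z := fun z => by
    have := (hh_grad z).hasFDerivAt.add ((hf_grad z).hasFDerivAt.const_mul η)
    rw [hasGradientAt_iff_hasFDerivAt, map_add, map_smul]
    exact this
  have hφ_lip : ∀ y z, ‖(h' y + η • f' y) - (h' z + η • f' z)‖ ≤ 1 / γ * ‖y - z‖ := fun y z => by
    have e : (h' y + η • f' y) - (h' z + η • f' z) = (h' y - h' z) + η • (f' y - f' z) := by
      module
    calc _ ≤ ‖h' y - h' z‖ + η * ‖f' y - f' z‖ := by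
          rw [e]
          refine (norm_add_le _ _).trans_eq ?_
          rw [norm_smul, Real.norm_of_nonneg hη_pos.le]
      _ ≤ Lh * ‖y - z‖ + η * (Lf * ‖y - z‖) :=
          add_le_add (hh_lip y z) (mul_le_mul_of_nonneg_left (hf_lip y z) hη_pos.le)
      _ = (Lh + η * Lf) * ‖y - z‖ := by ring
      _ ≤ 1 / γ * ‖y - z‖ := mul_le_mul_of_nonneg_right hstep_le (norm_nonneg _)
  have hdesc : ∀ k, (hbar (x (k + 1)) + η * fbar (x (k + 1))) - (hbar xstar + η * fbar xstar)
      ≤ 1 / (2 * γ) * ((1 - η * γ * μf) * ‖x k - xstar‖ ^ 2 - ‖x (k + 1) - xstar‖ ^ 2) := by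
    intro k
    have hlow : (h (x k) + η * f (x k)) + ⟪h' (x k) + η • f' (x k), xstar - x k⟫
        + (η * μf) / 2 * ‖xstar - x k‖ ^ 2 ≤ h xstar + η * f xstar := by
      have h1 := hh_conv.add_inner_le_of_hasGradientAt (hh_grad (x k)) xstar
      have h2 := hf_sc.add_inner_add_sq_le
        (hf_conv.add_inner_le_of_hasGradientAt (hf_grad (x k))) xstar
      rw [inner_add_left, real_inner_smul_left]
      linarith [mul_le_mul_of_nonneg_left h2 hη_pos.le]
    have hup := le_add_inner_add_sq_of_lipschitz_gradient hφ_grad hφ_lip (x k) (x (k + 1))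
    rw [show 1 / γ / 2 = 1 / (2 * γ) by field_simp] at hup
    have hmain := proximal_gradient_step_s15 (φ := fun z => h z + η * f z) hγ_pos hω_conv hup
      (hx_iter k) xstar hlow
    simp only [hfbar, hhbar]
    rw [show η * γ * μf = γ * (η * μf) by ring]
    linarith
  have hr : 0 < 1 - η * γ * μf := by linarith
  have hsum := sum_inv_pow_mul_le hr (by positivity) (fun k => sq_nonneg ‖x k - xstar‖) hdesc K
  have hθ_pos : ∀ k, 0 < θ k := fun k => by rw [hθ]; positivity
  have hS_ge : (K : ℝ) ^ (p + 1) ≤ ∑ k ∈ Finset.range K, θ k := by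
    have h1 := rpow_le_inv_one_sub_pow (a := p + 1) (zero_lt_one.trans hK) (hq ▸ hq1)
    rw [← hq] at h1
    have h2 := Finset.single_le_sum (f := θ) (fun k _ => (hθ_pos k).le)
      (Finset.mem_range.2 (Nat.sub_lt (zero_lt_one.trans hK) one_pos))
    rw [hθ (K - 1), Nat.sub_add_cancel hK.le] at h2
    exact h1.trans h2
  set S := ∑ k ∈ Finset.range K, θ k with hS
  have hKp : 0 < (K : ℝ) ^ (p + 1) := by positivity
  have hS_pos : 0 < S := hKp.trans_le hS_ge
  have hF_conv : ConvexOn ℝ Set.univ (fun z => hbar z + η * fbar z) := by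
    refine ConvexOn.add ?_ (ConvexOn.smul hη_pos.le ?_)
    · rw [hhbar']
      exact hh_conv.add hωh_conv
    · rw [hfbar']
      exact hf_conv.add hωf_conv
  have hjensen : hbar (xbar K) + η * fbar (xbar K)
      ≤ S⁻¹ * ∑ k ∈ Finset.range K, θ k * (hbar (x (k + 1)) + η * fbar (x (k + 1))) := by
    rw [hxbar]
    exact hF_conv.map_centerMass_le (fun k _ => (hθ_pos k).le) hS_pos fun _ _ => Set.mem_univ _
  have hmin : hbar xstar ≤ hbar (xbar K) := by
    rw [hX] at hxstar_mem
    exact hxstar_mem _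
  have hgap : S * (η * (fbar (xbar K) - fbar xstar)) ≤ 1 / (2 * γ) * ‖x 0 - xstar‖ ^ 2 := by
    simp only [← hθ, mul_sub, Finset.sum_sub_distrib] at hsum
    rw [← Finset.sum_mul, ← hS] at hsum
    rw [le_inv_mul_iff₀ hS_pos] at hjensen
    have := mul_le_mul_of_nonneg_left hmin hS_pos.le
    linarith
  rcases le_total (fbar (xbar K) - fbar xstar) 0 with hneg | hnonneg
  · exact hneg.trans (by positivity)
  have hfin : (K : ℝ) ^ (p + 1) * (η * (fbar (xbar K) - fbar xstar))
      ≤ 1 / (2 * γ) * ‖x 0 - xstar‖ ^ 2 :=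
    (mul_le_mul_of_nonneg_right hS_ge (mul_nonneg hη_pos.le hnonneg)).trans hgap
  rw [Real.rpow_add_one hK0.ne', hη] at hfin
  have hKp' : 0 < (K : ℝ) ^ p := by positivity
  rw [div_div, le_div_iff₀ (by positivity)]
  have e := mul_le_mul_of_nonneg_left hfin (by positivity : 0 ≤ 2 * γ * μf)
  have e1 : 2 * γ * μf * (1 / (2 * γ) * ‖x 0 - xstar‖ ^ 2) = μf * ‖x 0 - xstar‖ ^ 2 := by
    field_simp
  have e2 : 2 * γ * μf * ((K : ℝ) ^ p * K * ((p + 1) * Real.log K / (γ * μf * K)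
        * (fbar (xbar K) - fbar xstar)))
      = (fbar (xbar K) - fbar xstar) * (2 * (p + 1) * (Real.log K * (K : ℝ) ^ p)) := by
    field_simp
  linarith
end
end

section
/- Let (x_k, y_k) be the R-VFISTA iterates with constant regularization parameter η > 0. Then for every x ∈ E and every integer k ≥ 0: ( h̄(x_k) + η f̄(x_k) ) − ( h̄(x) + η f̄(x) ) ≤ (1 − 1/√κ_η)^k · ( ( h̄(x_0) + η f̄(x_0) ) − ( h̄(x) + η f̄(x) ) + (ημ_f/2)‖x_0 − x‖² ). -/
open scoped RealInnerProductSpace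
open Metric Filter

noncomputable section

section AcceleratedProxGradient

variable {E : Type*} [NormedAddCommGroup E] [InnerProductSpace ℝ E]

lemma HasGradientAt.hasDerivAt_line [CompleteSpace E] {f : E → ℝ} {g a d : E} {t : ℝ}
    (hf : HasGradientAt f g (a + t • d)) :
    HasDerivAt (fun s : ℝ => f (a + s • d)) ⟪g, d⟫ t := by
  have hline : HasDerivAt (fun s : ℝ => a + s • d) d t := by
    simpa using ((hasDerivAt_id t).smul_const d).const_add a
  exact (hf.hasFDerivAt.comp_hasDerivAt t hline).congr_deriv (by simp)

lemma le_quadratic_of_lipschitz_gradient [CompleteSpace E] {f : E → ℝ} {f' : E → E} {L : ℝ}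
    (hf : ∀ x, HasGradientAt f (f' x) x) (hL : ∀ x y, ‖f' x - f' y‖ ≤ L * ‖x - y‖) (a b : E) :
    f b ≤ f a + ⟪f' a, b - a⟫ + L / 2 * ‖b - a‖ ^ 2 := by
  set d := b - a with hd
  have hder (t : ℝ) : HasDerivAt
      (fun s : ℝ => f (a + s • d) - s * ⟪f' a, d⟫ - s ^ 2 * (L / 2 * ‖d‖ ^ 2))
      (⟪f' (a + t • d), d⟫ - ⟪f' a, d⟫ - 2 * t * (L / 2 * ‖d‖ ^ 2)) t := by
    have h2 := (hasDerivAt_id t).mul_const ⟪f' a, d⟫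
    have h3 := (hasDerivAt_pow 2 t).mul_const (L / 2 * ‖d‖ ^ 2)
    exact (((hf (a + t • d)).hasDerivAt_line.sub h2).sub h3).congr_deriv (by simp)
  have hanti : AntitoneOn
      (fun s : ℝ => f (a + s • d) - s * ⟪f' a, d⟫ - s ^ 2 * (L / 2 * ‖d‖ ^ 2)) (Set.Icc 0 1) := by
    refine antitoneOn_of_deriv_nonpos (convex_Icc 0 1)
      (fun t _ => (hder t).continuousAt.continuousWithinAt)
      (fun t _ => (hder t).differentiableAt.differentiableWithinAt) fun t ht => ?_
    rw [interior_Icc] at ht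
    rw [(hder t).deriv, ← inner_sub_left]
    have hlip := hL (a + t • d) a
    rw [add_sub_cancel_left, norm_smul, Real.norm_of_nonneg ht.1.le] at hlip
    have hcs := real_inner_le_norm (f' (a + t • d) - f' a) d
    nlinarith [mul_le_mul_of_nonneg_right hlip (norm_nonneg d)]
  have h01 := hanti (Set.left_mem_Icc.2 zero_le_one) (Set.right_mem_Icc.2 zero_le_one) zero_le_one
  simp only [zero_smul, one_smul, add_zero, hd, add_sub_cancel] at h01
  rw [← hd] at h01
  linarith

lemma ConvexOn.add_deriv_le [CompleteSpace E] {φ : E → ℝ} (hφ : ConvexOn ℝ Set.univ φ)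
    {a b : E} {c : ℝ} (hc : HasDerivAt (fun s : ℝ => φ (a + s • (b - a))) c 0) :
    φ a + c ≤ φ b := by
  have hconv : ConvexOn ℝ Set.univ (fun s : ℝ => φ (a + s • (b - a))) := by
    have := hφ.comp_affineMap (AffineMap.lineMap a b : ℝ →ᵃ[ℝ] E)
    rw [Set.preimage_univ] at this
    refine this.congr fun s _ => ?_
    simp [AffineMap.lineMap_apply, add_comm]
  have := hconv.le_slope_of_hasDerivAt (Set.mem_univ 0) (Set.mem_univ 1) zero_lt_one hc
  simp [slope_def_field] at this
  linarith

lemma StrongConvexOn.add_inner_add_le [CompleteSpace E] {f : E → ℝ} {m : ℝ}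
    (hsc : StrongConvexOn Set.univ m f) {g a : E} (hf : HasGradientAt f g a) (b : E) :
    f a + ⟪g, b - a⟫ + m / 2 * ‖b - a‖ ^ 2 ≤ f b := by
  rw [strongConvexOn_iff_convex] at hsc
  have h1 : HasDerivAt (fun s : ℝ => f (a + s • (b - a))) ⟪g, b - a⟫ 0 :=
    HasGradientAt.hasDerivAt_line (by simpa using hf)
  have h2 : HasDerivAt (fun s : ℝ => a + s • (b - a)) (b - a) 0 := by
    simpa using ((hasDerivAt_id (0 : ℝ)).smul_const (b - a)).const_add a
  have h3 := hsc.add_deriv_le (h1.sub (h2.norm_sq.const_mul (m / 2)))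
  simp only [zero_smul, add_zero] at h3
  have h4 : ‖b‖ ^ 2 = ‖a‖ ^ 2 + 2 * ⟪a, b - a⟫ + ‖b - a‖ ^ 2 := by
    rw [← norm_add_sq_real, add_sub_cancel]
  rw [h4] at h3
  linarith

lemma ConvexOn.inner_le_of_isMinOn_prox {ω : E → ℝ} (hω : ConvexOn ℝ Set.univ ω) {L : ℝ}
    (hL : 0 < L) {p w : E}
    (hp : ∀ u, ω p + L / 2 * ‖p - w‖ ^ 2 ≤ ω u + L / 2 * ‖u - w‖ ^ 2) (u : E) :
    ω p + L * ⟪w - p, u - p⟫ ≤ ω u := by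
  set A := ω u - ω p - L * ⟪w - p, u - p⟫ with hA
  set B := L / 2 * ‖u - p‖ ^ 2 with hB
  have hB0 : 0 ≤ B := by positivity
  have key (t : ℝ) (ht : 0 < t) (ht1 : t ≤ 1) : 0 ≤ A + t * B := by
    have h1 := hp (p + t • (u - p))
    have h2 := hω.2 (Set.mem_univ p) (Set.mem_univ u) (sub_nonneg.2 ht1) ht.le (by ring)
    have h3 : (1 - t) • p + t • u = p + t • (u - p) := by module
    have h4 : p + t • (u - p) - w = t • (u - p) - (w - p) := by module
    rw [h3] at h2
    rw [h4, norm_sub_sq_real (t • (u - p)) (w - p), norm_smul, real_inner_smul_left,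
      Real.norm_of_nonneg ht.le, real_inner_comm, norm_sub_rev p w] at h1
    simp only [smul_eq_mul] at h2
    have h5 : 0 ≤ t * (A + t * B) := by
      rw [hA, hB]
      linarith
    exact nonneg_of_mul_nonneg_right h5 ht
  suffices 0 ≤ A by linarith
  by_contra! hneg
  have hpos : 0 < B - A := by linarith
  have h := key (-A / (B - A)) (div_pos (by linarith) hpos) ((div_le_one hpos).2 (by linarith))
  have h' : A + -A / (B - A) * B = -(A ^ 2 / (B - A)) := by
    field_simp
    ring
  have : 0 < A ^ 2 / (B - A) := div_pos (by nlinarith) hpos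
  linarith

lemma prox_gradient_step_le [CompleteSpace E] {F ω : E → ℝ} {L m : ℝ} {g y p : E}
    (hL : 0 < L) (hω : ConvexOn ℝ Set.univ ω)
    (hupper : ∀ b, F b ≤ F y + ⟪g, b - y⟫ + L / 2 * ‖b - y‖ ^ 2)
    (hlower : ∀ b, F y + ⟪g, b - y⟫ + m / 2 * ‖b - y‖ ^ 2 ≤ F b)
    (hp : ∀ u, ω p + L / 2 * ‖p - (y - L⁻¹ • g)‖ ^ 2 ≤ ω u + L / 2 * ‖u - (y - L⁻¹ • g)‖ ^ 2)
    (u : E) :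
    F p + ω p + L * ⟪y - p, u - y⟫ + L / 2 * ‖y - p‖ ^ 2 + m / 2 * ‖u - y‖ ^ 2 ≤ F u + ω u := by
  have h1 := hω.inner_le_of_isMinOn_prox hL hp u
  have h2 := hupper p
  have h3 := hlower u
  have h4 : L * ⟪y - L⁻¹ • g - p, u - p⟫
      = L * ⟪y - p, u - y⟫ + L * ‖y - p‖ ^ 2 - ⟪g, u - y⟫ + ⟪g, p - y⟫ := by
    have e1 : y - L⁻¹ • g - p = (y - p) - L⁻¹ • g := by abel
    have e2 : u - p = (u - y) + (y - p) := by abel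
    have e3 : p - y = -(y - p) := by abel
    rw [e1, e2, e3, inner_neg_right, inner_sub_left, inner_add_right, inner_add_right,
      real_inner_smul_left, real_inner_smul_left, real_inner_self_eq_norm_sq]
    field_simp
    ring
  rw [h4] at h1
  rw [norm_sub_rev p y] at h2
  linarith

/-- One step of the accelerated scheme contracts the Lyapunov function
`G x - G z + L * θ ^ 2 / 2 * ‖v - z‖ ^ 2`, where `v = y + θ⁻¹ • (y - x)`. -/
lemma accelerated_step_contraction {G : E → ℝ} {L θ : ℝ} {x y p q : E} (hL : 0 < L)
    (hθ : 0 < θ) (hθ1 : θ ≤ 1)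
    (hstep : ∀ u, G p + L * ⟪y - p, u - y⟫ + L / 2 * ‖y - p‖ ^ 2
      + L * θ ^ 2 / 2 * ‖u - y‖ ^ 2 ≤ G u)
    (hq : q = p + ((1 - θ) / (1 + θ)) • (p - x)) (z : E) :
    G p - G z + L * θ ^ 2 / 2 * ‖q + θ⁻¹ • (q - p) - z‖ ^ 2
      ≤ (1 - θ) * (G x - G z + L * θ ^ 2 / 2 * ‖y + θ⁻¹ • (y - x) - z‖ ^ 2) := by
  have hθ' : 0 ≤ 1 - θ := by linarith
  have hθ2 : (1 + θ) ≠ 0 := by positivity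
  set a := y - p with ha
  set v := y + θ⁻¹ • (y - x) - z with hv
  set b := (1 - θ) • (x - y) + θ • (z - y) with hb
  have hx := mul_le_mul_of_nonneg_left (hstep x) hθ'
  have hz := mul_le_mul_of_nonneg_left (hstep z) hθ.le
  have hbv : b = -(θ • ((1 - θ) • v + θ • (y - z))) := by
    rw [hb, hv]
    match_scalars <;> field_simp <;> ring
  have hqv : θ • (q + θ⁻¹ • (q - p) - z) = -(a + b) := by
    rw [hq, ha, hb]
    match_scalars <;> field_simp <;> ring
  have hq2 : θ ^ 2 * ‖q + θ⁻¹ • (q - p) - z‖ ^ 2 = ‖a‖ ^ 2 + 2 * ⟪a, b⟫ + ‖b‖ ^ 2 := by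
    rw [← norm_add_sq_real, ← norm_neg (a + b), ← hqv, norm_smul, Real.norm_of_nonneg hθ.le]
    ring
  have hin : ⟪a, b⟫ = (1 - θ) * ⟪a, x - y⟫ + θ * ⟪a, z - y⟫ := by
    rw [hb, inner_add_right, real_inner_smul_right, real_inner_smul_right]
  have hb2 : ‖b‖ ^ 2 ≤ θ ^ 2 * ((1 - θ) * ‖v‖ ^ 2 + θ * ‖z - y‖ ^ 2) := by
    have e : ‖b‖ ^ 2 = θ ^ 2 * ‖(1 - θ) • v + θ • (y - z)‖ ^ 2 := by
      rw [hbv, norm_neg, norm_smul, Real.norm_of_nonneg hθ.le]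
      ring
    rw [e, norm_add_sq_real, norm_smul, norm_smul, Real.norm_of_nonneg hθ.le,
      Real.norm_of_nonneg hθ', real_inner_smul_left, real_inner_smul_right, norm_sub_rev z y]
    have hsq := norm_sub_sq_real v (y - z)
    have hnn : 0 ≤ (1 - θ) * θ * ‖v - (y - z)‖ ^ 2 := by positivity
    rw [hsq] at hnn
    refine mul_le_mul_of_nonneg_left ?_ (sq_nonneg θ)
    linarith
  have hb3 := mul_le_mul_of_nonneg_left hb2 (half_pos hL).le
  have hdrop : 0 ≤ (1 - θ) * (L * θ ^ 2 / 2 * ‖x - y‖ ^ 2) := by positivity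
  have hq3 : L * θ ^ 2 / 2 * ‖q + θ⁻¹ • (q - p) - z‖ ^ 2
      = L / 2 * (‖a‖ ^ 2 + 2 * ⟪a, b⟫ + ‖b‖ ^ 2) := by
    rw [← hq2]
    ring
  rw [hq3, hin]
  linarith

end AcceleratedProxGradient

theorem stmt_18
    {n : ℕ}
    (f h ωf ωh : EuclideanSpace ℝ (Fin n) → ℝ)
    (f' h' : EuclideanSpace ℝ (Fin n) → EuclideanSpace ℝ (Fin n))
    (Lf Lh μf : ℝ)
    (hμf_pos : 0 < μf) (hμf_le : μf ≤ Lf) (hLh_pos : 0 < Lh)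
    (hf_grad : ∀ x, HasGradientAt f (f' x) x)
    (hf_lip : ∀ x y, ‖f' x - f' y‖ ≤ Lf * ‖x - y‖)
    (hf_sc : StrongConvexOn Set.univ μf f)
    (hh_grad : ∀ x, HasGradientAt h (h' x) x)
    (hh_lip : ∀ x y, ‖h' x - h' y‖ ≤ Lh * ‖x - y‖)
    (hh_conv : ConvexOn ℝ Set.univ h)
    (hωf_conv : ConvexOn ℝ Set.univ ωf)
    (hωh_conv : ConvexOn ℝ Set.univ ωh)
    (fbar hbar : EuclideanSpace ℝ (Fin n) → ℝ)
    (hfbar : ∀ x, fbar x = f x + ωf x)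
    (hhbar : ∀ x, hbar x = h x + ωh x)
    (η : ℝ) (hη_pos : 0 < η)
    (x y : ℕ → EuclideanSpace ℝ (Fin n))
    (κ γ : ℝ)
    (hκ : κ = (Lh + η * Lf) / (η * μf))
    (hγ : γ = 1 / (Lh + η * Lf))
    (hy0 : y 0 = x 0)
    (hx_iter : ∀ k u,
      ωh (x (k+1)) + η * ωf (x (k+1))
        + 1 / (2*γ) * ‖x (k+1) - (y k - γ • (h' (y k) + η • f' (y k)))‖ ^ 2
      ≤ ωh u + η * ωf u
        + 1 / (2*γ) * ‖u - (y k - γ • (h' (y k) + η • f' (y k)))‖ ^ 2)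
    (hy_iter : ∀ k, y (k+1) = x (k+1)
        + ((Real.sqrt κ - 1) / (Real.sqrt κ + 1)) • (x (k+1) - x k))
    :
    ∀ (z : EuclideanSpace ℝ (Fin n)) (k : ℕ),
      (hbar (x k) + η * fbar (x k)) - (hbar z + η * fbar z)
        ≤ (1 - 1 / Real.sqrt κ) ^ k *
            ((hbar (x 0) + η * fbar (x 0)) - (hbar z + η * fbar z)
              + η * μf / 2 * ‖x 0 - z‖ ^ 2) := by
  intro z k
  have hLf : 0 < Lf := hμf_pos.trans_le hμf_le
  have hηL : 0 < η * Lf := mul_pos hη_pos hLf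
  have hm : 0 < η * μf := mul_pos hη_pos hμf_pos
  set L := Lh + η * Lf with hLdef
  have hL : 0 < L := by positivity
  have hκ1 : 1 ≤ κ := by
    rw [hκ, one_le_div hm]
    linarith [mul_le_mul_of_nonneg_left hμf_le hη_pos.le]
  have hs1 : 1 ≤ Real.sqrt κ := Real.one_le_sqrt.2 hκ1
  have hs0 : 0 < Real.sqrt κ := by linarith
  rw [one_div]
  set θ := (Real.sqrt κ)⁻¹ with hθdef
  have hθ : 0 < θ := inv_pos.2 hs0
  have hθ1 : θ ≤ 1 := inv_le_one_of_one_le₀ hs1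
  have hLθ : L * θ ^ 2 = η * μf := by
    rw [hθdef, inv_pow, Real.sq_sqrt (by linarith), hκ]
    field_simp
  have hcoef : (Real.sqrt κ - 1) / (Real.sqrt κ + 1) = (1 - θ) / (1 + θ) := by
    rw [hθdef]
    field_simp
  set F : EuclideanSpace ℝ (Fin n) → ℝ := fun u => h u + η * f u with hF
  set ω : EuclideanSpace ℝ (Fin n) → ℝ := fun u => ωh u + η * ωf u with hωdef
  have hω : ConvexOn ℝ Set.univ ω := hωh_conv.add (hωf_conv.smul hη_pos.le)
  have hG (u) : hbar u + η * fbar u = F u + ω u := by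
    rw [hhbar, hfbar, hF, hωdef]
    ring
  have hh_sc : StrongConvexOn Set.univ 0 h := strongConvexOn_zero.2 hh_conv
  have hstep (k : ℕ) (u : EuclideanSpace ℝ (Fin n)) :
      F (x (k + 1)) + ω (x (k + 1)) + L * ⟪y k - x (k + 1), u - y k⟫
        + L / 2 * ‖y k - x (k + 1)‖ ^ 2 + L * θ ^ 2 / 2 * ‖u - y k‖ ^ 2 ≤ F u + ω u := by
    refine prox_gradient_step_le (g := h' (y k) + η • f' (y k)) hL hω (fun b => ?_) (fun b => ?_)
      (fun u => ?_) u
    · have h1 := le_quadratic_of_lipschitz_gradient hh_grad hh_lip (y k) b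
      have h2 := mul_le_mul_of_nonneg_left
        (le_quadratic_of_lipschitz_gradient hf_grad hf_lip (y k) b) hη_pos.le
      rw [inner_add_left, real_inner_smul_left, hLdef]
      simp only [hF]
      linarith
    · have h1 := hh_sc.add_inner_add_le (hh_grad (y k)) b
      have h2 := mul_le_mul_of_nonneg_left (hf_sc.add_inner_add_le (hf_grad (y k)) b) hη_pos.le
      rw [inner_add_left, real_inner_smul_left, hLθ]
      simp only [hF]
      linarith
    · have hit := hx_iter k u
      have hγ1 : γ = L⁻¹ := by rw [hγ, one_div]
      have hγ2 : 1 / (2 * γ) = L / 2 := by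
        rw [hγ1]
        field_simp
      rwa [hγ2, hγ1] at hit
  have hV (k : ℕ) : F (x k) + ω (x k) - (F z + ω z)
        + L * θ ^ 2 / 2 * ‖y k + θ⁻¹ • (y k - x k) - z‖ ^ 2
      ≤ (1 - θ) ^ k * (F (x 0) + ω (x 0) - (F z + ω z) + L * θ ^ 2 / 2 * ‖x 0 - z‖ ^ 2) := by
    induction k with
    | zero => simp [hy0]
    | succ k ih =>
      have hq := hy_iter k
      rw [hcoef] at hq
      refine (accelerated_step_contraction (G := fun u => F u + ω u) hL hθ hθ1 (hstep k) hq
        z).trans ?_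
      rw [pow_succ' (1 - θ), mul_assoc]
      exact mul_le_mul_of_nonneg_left ih (by linarith)
  have hfin := hV k
  have hnn : 0 ≤ L * θ ^ 2 / 2 * ‖y k + θ⁻¹ • (y k - x k) - z‖ ^ 2 := by positivity
  rw [hG, hG, hG, ← hLθ]
  linarith
end
end
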